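/- arXiv:2203.14798 — 3 statements merged into one kernel-verified Lean document; each statement's English description precedes it below -/
import Mathlib

section
/- Let T be a minimum spanning tree of the complete weighted graph on (V, w), let T' be a subtree of T, and let e = (u,v) be a pair of vertices with u ∈ V(T') and v ∉ V(T'). Then adv({e}, T') ≤ adv*(T'). -/
open scoped Classical

variable {V : Type*}

/-- `w` is a metric on `V`: symmetric, zero on the diagonal, positive on pairs of distinct
points, and satisfying the triangle inequality. -/
structure IsMetric (w : V → V → ℝ) : Prop where
  symm : ∀ x y, w x y = w y x
  self : ∀ x, w x x = 0
  pos : ∀ x y, x ≠ y → 0 < w x y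
  triangle : ∀ x y z, w x z ≤ w x y + w y z

/-- The weight of an unordered pair of vertices (for symmetric `w` this is just `w`). -/
noncomputable def sym2Weight (w : V → V → ℝ) : Sym2 V → ℝ :=
  Sym2.lift ⟨fun a b => (w a b + w b a) / 2, fun a b => by ring⟩

/-- The total weight of a set of unordered pairs of vertices. -/
noncomputable def setWeight (w : V → V → ℝ) (S : Set (Sym2 V)) : ℝ :=
  ∑ᶠ e ∈ S, sym2Weight w e

/-- `MST(w)`: the minimum total weight of a spanning tree of the complete graph on `V`. -/
noncomputable def MSTcost (V : Type*) [Fintype V] (w : V → V → ℝ) : ℝ :=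
  sInf { x | ∃ T : SimpleGraph V, T.IsTree ∧ x = setWeight w T.edgeSet }

/-- The cost of the tour visiting the points of `V` in the cyclic order given by `f`. -/
noncomputable def tourCost (V : Type*) [Fintype V] (w : V → V → ℝ)
    (f : Fin (Fintype.card V) → V) : ℝ :=
  ∑ i : Fin (Fintype.card V),
    w (f i) (f ⟨((i : ℕ) + 1) % Fintype.card V, Nat.mod_lt _ i.pos⟩)

/-- `TSP(w)`: the minimum cost over all cyclic orderings of the points of `V`. -/
noncomputable def TSPcost (V : Type*) [Fintype V] (w : V → V → ℝ) : ℝ :=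
  sInf { x | ∃ f : Fin (Fintype.card V) ≃ V, x = tourCost V w ⇑f }

/-- The pair `f` is covered by the pair `e`: `f` lies on a path in `T` between the two
endpoints of `e` (in a tree, this path is unique). -/
def covers (T : SimpleGraph V) (e f : Sym2 V) : Prop :=
  ∃ (u v : V) (p : T.Walk u v), e = s(u, v) ∧ p.IsPath ∧ f ∈ p.edges

/-- `cov(E')`: the set of edges of `T` covered by at least one pair in `E'`. -/
def cov (T : SimpleGraph V) (E' : Set (Sym2 V)) : Set (Sym2 V) :=
  { f | f ∈ T.edgeSet ∧ ∃ e ∈ E', covers T e f }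

/-- A subtree of the tree `T` is a connected subgraph of `T`. -/
def IsSubtree (T : SimpleGraph V) (T' : T.Subgraph) : Prop :=
  T'.Connected

/-- `cov(E', T') = cov(E') ∩ E(T')`. -/
def covOn (T : SimpleGraph V) (E' : Set (Sym2 V)) (T' : T.Subgraph) : Set (Sym2 V) :=
  cov T E' ∩ T'.edgeSet

/-- The cover advantage of `E'` on `T'`: `w(cov(E', T')) − w(E')`. -/
noncomputable def advOf (w : V → V → ℝ) (T : SimpleGraph V)
    (E' : Set (Sym2 V)) (T' : T.Subgraph) : ℝ :=
  setWeight w (covOn T E' T') - setWeight w E'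

/-- `adv(T')`: the optimal cover advantage of `T'`, i.e. the maximum of `adv(E', T')`
over all sets `E'` of pairs each having at least one endpoint in `V(T')`. -/
noncomputable def adv (w : V → V → ℝ) (T : SimpleGraph V) (T' : T.Subgraph) : ℝ :=
  sSup { x | ∃ E' : Set (Sym2 V),
    (∀ e ∈ E', ∃ u ∈ T'.verts, u ∈ e) ∧ x = advOf w T E' T' }

/-- A vertex of `T'` is special iff its degree in `T'` is not `2`. -/
def IsSpecial (T : SimpleGraph V) (T' : T.Subgraph) (v : V) : Prop :=
  v ∈ T'.verts ∧ (T'.neighborSet v).ncard ≠ 2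

/-- `adv*(T')`: the optimal special cover advantage of `T'`, i.e. the maximum of
`adv(E', T')` over all sets `E'` of pairs each having at least one endpoint that is a
special vertex of `T'`. -/
noncomputable def advStar (w : V → V → ℝ) (T : SimpleGraph V) (T' : T.Subgraph) : ℝ :=
  sSup { x | ∃ E' : Set (Sym2 V),
    (∀ e ∈ E', ∃ u, IsSpecial T T' u ∧ u ∈ e) ∧ x = advOf w T E' T' }

theorem IsMetric.sym2Weight_mk {w : V → V → ℝ} (hw : IsMetric w) (a b : V) :
    sym2Weight w s(a, b) = w a b := by
  change (w a b + w b a) / 2 = w a b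
  rw [hw.symm b a]
  ring

theorem IsMetric.setWeight_singleton_mk {w : V → V → ℝ} (hw : IsMetric w) (a b : V) :
    setWeight w {s(a, b)} = w a b := by
  rw [setWeight, finsum_mem_singleton, hw.sym2Weight_mk]

theorem setWeight_insert [Finite V] (w : V → V → ℝ) {f : Sym2 V} {S : Set (Sym2 V)}
    (hf : f ∉ S) : setWeight w (insert f S) = sym2Weight w f + setWeight w S :=
  finsum_mem_insert _ hf S.toFinite

theorem covers_mk_iff {T : SimpleGraph V} (hT : T.IsAcyclic) {a b : V} {p : T.Walk a b}
    (hp : p.IsPath) (f : Sym2 V) : covers T s(a, b) f ↔ f ∈ p.edges := by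
  refine ⟨?_, fun hf => ⟨a, b, p, rfl, hp, hf⟩⟩
  rintro ⟨c, d, q, hcd, hq, hf⟩
  rcases Sym2.eq_iff.1 hcd with ⟨rfl, rfl⟩ | ⟨rfl, rfl⟩
  · have h := congrArg Subtype.val ((hT.subsingleton_path _ _).elim ⟨p, hp⟩ ⟨q, hq⟩)
    exact (show p = q from h) ▸ hf
  · have h := congrArg Subtype.val ((hT.subsingleton_path _ _).elim ⟨p, hp⟩ ⟨q.reverse, hq.reverse⟩)
    rw [show p = q.reverse from h, SimpleGraph.Walk.edges_reverse]
    exact List.mem_reverse.2 hf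

theorem covOn_singleton_mk {T : SimpleGraph V} (hT : T.IsAcyclic) (T' : T.Subgraph) {a b : V}
    {p : T.Walk a b} (hp : p.IsPath) :
    covOn T {s(a, b)} T' = {f | f ∈ p.edges} ∩ T'.edgeSet := by
  ext f
  simp only [covOn, cov, Set.mem_inter_iff, Set.mem_ofPred_eq, Set.mem_singleton_iff,
    exists_eq_left, covers_mk_iff hT hp]
  exact ⟨fun h => ⟨h.1.2, h.2⟩, fun h => ⟨⟨T'.edgeSet_subset h.2, h.1⟩, h.2⟩⟩

/-- Extending a path at its start by an edge of `T'` does not decrease the cover advantage of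
the pair of its endpoints. -/
theorem advOf_singleton_le_of_adj [Finite V] {w : V → V → ℝ} (hw : IsMetric w)
    {T : SimpleGraph V} (hT : T.IsAcyclic) {T' : T.Subgraph} {s s' v : V} {p : T.Walk s v}
    (hp : p.IsPath) (h : T'.Adj s' s) (hs' : s' ∉ p.support) :
    advOf w T {s(s, v)} T' ≤ advOf w T {s(s', v)} T' := by
  have hq : (SimpleGraph.Walk.cons h.adj_sub p).IsPath := hp.cons hs'
  have hcov : covOn T {s(s', v)} T' = insert s(s', s) (covOn T {s(s, v)} T') := by
    rw [covOn_singleton_mk hT T' hp, covOn_singleton_mk hT T' hq]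
    ext f
    simp only [SimpleGraph.Walk.edges_cons, List.mem_cons, Set.mem_inter_iff, Set.mem_ofPred_eq,
      Set.mem_insert_iff]
    have hf : f = s(s', s) → f ∈ T'.edgeSet := by
      rintro rfl
      exact h
    tauto
  have hnot : s(s', s) ∉ covOn T {s(s, v)} T' := by
    rw [covOn_singleton_mk hT T' hp]
    exact fun hmem => hs' (p.fst_mem_support_of_mem_edges hmem.1)
  rw [advOf, advOf, hcov, setWeight_insert w hnot, hw.setWeight_singleton_mk,
    hw.setWeight_singleton_mk, hw.sym2Weight_mk]
  linarith [hw.triangle s' s v]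

theorem exists_adj_notMem_support_of_not_isSpecial {T : SimpleGraph V} (hT : T.IsAcyclic)
    {T' : T.Subgraph} {s v : V} {p : T.Walk s v} (hp : p.IsPath) (hs : s ∈ T'.verts)
    (hspec : ¬ IsSpecial T T' s) : ∃ s', T'.Adj s' s ∧ s' ∉ p.support := by
  have hcard : (T'.neighborSet s).ncard = 2 := by
    by_contra hne
    exact hspec ⟨hs, hne⟩
  obtain ⟨x, y, hxy, hset⟩ := Set.ncard_eq_two.1 hcard
  have hx : T'.Adj s x := show x ∈ T'.neighborSet s by simp [hset]
  have hy : T'.Adj s y := show y ∈ T'.neighborSet s by simp [hset]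
  by_contra! hcon
  have hx' := hT.eq_snd_of_adj_start hp hx.adj_sub (hcon x hx.symm)
  have hy' := hT.eq_snd_of_adj_start hp hy.adj_sub (hcon y hy.symm)
  exact hxy (hx'.trans hy'.symm)

theorem exists_isSpecial_advOf_singleton_le [Finite V] {w : V → V → ℝ} (hw : IsMetric w)
    {T : SimpleGraph V} (hT : T.IsAcyclic) {T' : T.Subgraph} {s v : V} (p : T.Walk s v)
    (hp : p.IsPath) (hs : s ∈ T'.verts) :
    ∃ t, IsSpecial T T' t ∧ advOf w T {s(s, v)} T' ≤ advOf w T {s(t, v)} T' := by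
  have := Fintype.ofFinite V
  induction hn : Fintype.card V - p.length using Nat.strong_induction_on generalizing s with
  | _ n ih =>
    by_cases hspec : IsSpecial T T' s
    · exact ⟨s, hspec, le_rfl⟩
    obtain ⟨s', hadj, hs'⟩ := exists_adj_notMem_support_of_not_isSpecial hT hp hs hspec
    have hq : (SimpleGraph.Walk.cons hadj.adj_sub p).IsPath := hp.cons hs'
    have hlt := hq.length_lt
    rw [SimpleGraph.Walk.length_cons] at hlt
    obtain ⟨t, ht, hle⟩ := ih _ (by rw [SimpleGraph.Walk.length_cons]; omega) _ hq
      hadj.fst_mem rfl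
    exact ⟨t, ht, (advOf_singleton_le_of_adj hw hT hp hadj hs').trans hle⟩

theorem advOf_le_advStar [Finite V] (w : V → V → ℝ) (T : SimpleGraph V) (T' : T.Subgraph)
    {E' : Set (Sym2 V)} (hE' : ∀ e ∈ E', ∃ u, IsSpecial T T' u ∧ u ∈ e) :
    advOf w T E' T' ≤ advStar w T T' := by
  refine le_csSup (Set.Finite.bddAbove ?_) ⟨E', hE', rfl⟩
  refine (Set.finite_range fun E' : Set (Sym2 V) => advOf w T E' T').subset ?_
  rintro x ⟨F, -, rfl⟩
  exact ⟨F, rfl⟩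

/-- If `T` is a minimum spanning tree of the complete weighted graph on
`(V, w)`, `T'` is a subtree of `T`, and `e = (u,v)` is a pair of vertices with
`u ∈ V(T')` and `v ∉ V(T')`, then `adv({e}, T') ≤ adv*(T')`. -/
theorem advOf_single_edge_le_advStar
    {V : Type*} [Fintype V] (w : V → V → ℝ) (hw : IsMetric w)
    (T : SimpleGraph V) (hT : T.IsTree)
    (hTmst : setWeight w T.edgeSet = MSTcost V w)
    (T' : T.Subgraph) (hT' : IsSubtree T T')
    (u v : V) (hu : u ∈ T'.verts) (hv : v ∉ T'.verts) :
    advOf w T {s(u, v)} T' ≤ advStar w T T' := by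
  obtain ⟨p, hp, -⟩ := hT.existsUnique_path u v
  obtain ⟨t, ht, hle⟩ := exists_isSpecial_advOf_singleton_le hw hT.isAcyclic p hp hu
  refine hle.trans (advOf_le_advStar w T T' ?_)
  rintro e rfl
  exact ⟨t, ht, Sym2.mem_mk_left t v⟩
end

section
/- Let T be a minimum spanning tree of the complete weighted graph on (V, w), let 0 < α < 1 and 0 < β < 1 be constants, and let E* be a set of pairs of vertices satisfying w(E*) ≤ α·w(cov(E*)) and w(cov(E*)) ≥ β·MST(w). Then TSP(w) ≤ (2 − (1 − α)·β/2)·MST(w). -/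
open scoped Classical

variable {V : Type*}

/-- Among the subsets of `E`, those meeting `{e | p e}` evenly make up exactly half, provided
some element of `E` satisfies `p`. -/
lemma sum_powerset_even_filter {ι : Type*} (E : Finset ι) (p : ι → Prop) [DecidablePred p]
    (h : ∃ e ∈ E, p e) :
    ∑ S ∈ E.powerset, (if Even (S.filter p).card then (1 : ℝ) else 0) = 2 ^ E.card / 2 := by
  have h0 : ∑ S ∈ E.powerset, ∏ e ∈ S, (if p e then (-1 : ℝ) else 1) = 0 := by
    rw [← Finset.prod_one_add]
    obtain ⟨e, he, hp⟩ := h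
    exact Finset.prod_eq_zero he (by simp [hp])
  have h1 : ∀ S ∈ E.powerset, (if Even (S.filter p).card then (1 : ℝ) else 0) =
      1 / 2 + (∏ e ∈ S, (if p e then (-1 : ℝ) else 1)) / 2 := by
    intro S _
    rw [Finset.prod_ite, Finset.prod_const, Finset.prod_const_one, mul_one]
    split_ifs with hS
    · rw [hS.neg_one_pow]; norm_num
    · rw [(Nat.not_even_iff_odd.mp hS).neg_one_pow]; norm_num
  rw [Finset.sum_congr rfl h1, Finset.sum_add_distrib, ← Finset.sum_div, ← Finset.sum_div, h0]
  simp [Finset.card_powerset]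

/-- The endpoints of an unordered pair, as a vector over `ZMod 2`. -/
noncomputable def sym2Boundary : Sym2 V → V → ZMod 2 :=
  Sym2.lift ⟨fun a b => Pi.single a 1 + Pi.single b 1, fun _ _ => add_comm _ _⟩

lemma sym2Boundary_mk (a b : V) :
    sym2Boundary s(a, b) = Pi.single a 1 + Pi.single b 1 := rfl

lemma zmod_two_add_self (x : V → ZMod 2) : x + x = 0 := by
  funext v
  exact CharTwo.add_self_eq_zero (x v)

/-- `IsRoute a b l N`: the list `l` of vertices is a walk from `a` to `b` whose steps form the
multiset `N`. -/
inductive IsRoute : V → V → List V → Multiset (Sym2 V) → Prop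
  | nil (a : V) : IsRoute a a [a] 0
  | cons (a : V) {c b : V} {l : List V} {N : Multiset (Sym2 V)} (h : IsRoute c b l N) :
      IsRoute a b (a :: l) (s(a, c) ::ₘ N)

namespace IsRoute

lemma exists_eq_cons {a b : V} {l : List V} {N : Multiset (Sym2 V)} (h : IsRoute a b l N) :
    ∃ t, l = a :: t := by
  cases h <;> exact ⟨_, rfl⟩

lemma start_mem {a b : V} {l : List V} {N : Multiset (Sym2 V)} (h : IsRoute a b l N) :
    a ∈ l := by
  obtain ⟨t, rfl⟩ := h.exists_eq_cons
  simp

lemma mem_of_mem_edges {a b : V} {l : List V} {N : Multiset (Sym2 V)} (h : IsRoute a b l N) :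
    ∀ e ∈ N, ∀ v ∈ e, v ∈ l := by
  induction h with
  | nil a => simp
  | cons a h ih =>
    intro e he v hv
    rcases Multiset.mem_cons.mp he with rfl | he
    · rcases Sym2.mem_iff.mp hv with rfl | rfl
      · simp
      · exact List.mem_cons_of_mem _ h.start_mem
    · exact List.mem_cons_of_mem _ (ih e he v hv)

lemma append {a b c : V} {l l' : List V} {N N' : Multiset (Sym2 V)} (h : IsRoute a b l N)
    (h' : IsRoute b c l' N') :
    ∃ k, IsRoute a c k (N + N') ∧ ∀ v, v ∈ k ↔ v ∈ l ∨ v ∈ l' := by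
  induction h with
  | nil a =>
    refine ⟨l', by simpa using h', fun v => ?_⟩
    have := h'.start_mem
    aesop
  | cons a h ih =>
    obtain ⟨k, hk, hv⟩ := ih h'
    refine ⟨a :: k, by simpa using hk.cons a, fun v => ?_⟩
    simp [hv, or_assoc]

lemma sum_boundary {a b : V} {l : List V} {N : Multiset (Sym2 V)} (h : IsRoute a b l N) :
    (N.map sym2Boundary).sum = Pi.single a 1 + Pi.single b 1 := by
  induction h with
  | nil a => simp [zmod_two_add_self]
  | @cons a c b l N h ih =>
    rw [Multiset.map_cons, Multiset.sum_cons, ih, sym2Boundary_mk]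
    have := zmod_two_add_self (Pi.single c (1 : ZMod 2))
    linear_combination this

end IsRoute

/-- If `a` and `b` are the only vertices of odd degree in a multigraph `M` (or `a = b` and there
are none), then some walk from `a` to `b` in `M` without repeated edges visits the whole connected
component of `a`. -/
lemma exists_isRoute (M : Multiset (Sym2 V)) (a b : V)
    (hM : (M.map sym2Boundary).sum = Pi.single a 1 + Pi.single b 1) :
    ∃ l N, N ≤ M ∧ IsRoute a b l N ∧ ∀ e ∈ M, ∀ u ∈ e, ∀ v ∈ e, u ∈ l → v ∈ l := by
  induction hn : M.card using Nat.strong_induction_on generalizing M a b with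
  | _ n ih =>
  subst hn
  by_cases hinc : ∃ e ∈ M, a ∈ e
  · obtain ⟨e, he, hae⟩ := hinc
    obtain ⟨c, rfl⟩ := hae
    obtain ⟨M, rfl⟩ := Multiset.exists_cons_of_mem he
    rw [Multiset.map_cons, Multiset.sum_cons, sym2Boundary_mk] at hM
    have hM' : (M.map sym2Boundary).sum = Pi.single c 1 + Pi.single b 1 := by
      have := zmod_two_add_self (Pi.single c (1 : ZMod 2))
      linear_combination hM - this
    obtain ⟨l, N, hN, hl, hcl⟩ := ih M.card (by simp) M c b hM' rfl
    by_cases hal : a ∈ l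
    · refine ⟨a :: l, s(a, c) ::ₘ N, by simpa using hN, hl.cons a, ?_⟩
      intro e he u hu v hv huv
      rcases Multiset.mem_cons.mp he with rfl | he
      · exact (hl.cons a).mem_of_mem_edges _ (Multiset.mem_cons_self _ _) v hv
      · have : u ∈ l := by
          rcases List.mem_cons.mp huv with rfl | h
          exacts [hal, h]
        exact List.mem_cons_of_mem _ (hcl e he u hu v hv this)
    · obtain ⟨R, rfl⟩ := Multiset.le_iff_exists_add.mp hN
      have hR : (R.map sym2Boundary).sum = Pi.single a 1 + Pi.single a 1 := by
        rw [zmod_two_add_self]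
        rw [Multiset.map_add, Multiset.sum_add, hl.sum_boundary] at hM'
        exact add_eq_left.mp hM'
      obtain ⟨l', N', hN', hl', hcl'⟩ := ih R.card (by simp) R a a hR rfl
      obtain ⟨k, hk, hkv⟩ := hl'.append (hl.cons a)
      refine ⟨k, _, ?_, hk, ?_⟩
      · rw [← Multiset.cons_add, add_comm]
        exact add_le_add_right hN' _
      · intro e he u hu v hv huv
        rcases Multiset.mem_cons.mp he with rfl | he
        · exact hk.mem_of_mem_edges _ (by simp) v hv
        · rw [hkv] at huv ⊢
          rcases Multiset.mem_add.mp he with heN | heR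
          · exact Or.inr (List.mem_cons_of_mem _ (hl.mem_of_mem_edges e heN v hv))
          · rcases huv with h | h
            · exact Or.inl (hcl' e heR u hu v hv h)
            · rcases List.mem_cons.mp h with rfl | h
              · exact Or.inl (hcl' e heR u hu v hv hl'.start_mem)
              · exact Or.inr (List.mem_cons_of_mem _ (hcl e he u hu v hv h))
  · push Not at hinc
    have hab : a = b := by
      by_contra hab
      have h0 : ∀ K : Multiset (Sym2 V), (∀ e ∈ K, a ∉ e) → (K.map sym2Boundary).sum a = 0 := by
        intro K
        induction K using Multiset.induction_on with
        | empty => simp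
        | cons e K ihK =>
          intro hK
          have he := hK e (Multiset.mem_cons_self _ _)
          induction e with
          | _ x y =>
          rw [Sym2.mem_iff, not_or] at he
          simp [sym2Boundary_mk, ihK fun e he => hK e (Multiset.mem_cons_of_mem he),
            Pi.single_eq_of_ne he.1, Pi.single_eq_of_ne he.2]
      have := h0 M hinc
      simp [hM, Pi.single_eq_of_ne hab] at this
    subst hab
    refine ⟨[a], 0, Multiset.zero_le _, .nil a, ?_⟩
    intro e he u hu v hv hua
    rw [List.mem_singleton] at hua
    subst hua
    exact absurd hu (hinc e he)

/-- The total `w`-length of the steps of a list of vertices. -/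
def listCost (w : V → V → ℝ) : List V → ℝ
  | [] => 0
  | [_] => 0
  | a :: b :: l => w a b + listCost w (b :: l)

namespace IsMetric

variable {w : V → V → ℝ}

lemma nonneg (hw : IsMetric w) (x y : V) : 0 ≤ w x y := by
  by_cases h : x = y
  · rw [h, hw.self]
  · exact (hw.pos x y h).le

lemma sym2Weight_mk_s10 (hw : IsMetric w) (x y : V) : sym2Weight w s(x, y) = w x y := by
  simp [sym2Weight, hw.symm y x]

lemma sym2Weight_nonneg (hw : IsMetric w) (e : Sym2 V) : 0 ≤ sym2Weight w e := by
  induction e with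
  | _ x y => rw [hw.sym2Weight_mk_s10]; exact hw.nonneg x y

lemma listCost_cons_le (hw : IsMetric w) (a b : V) (l : List V) :
    listCost w (a :: l) ≤ w a b + listCost w (b :: l) := by
  cases l with
  | nil => simp [listCost, hw.nonneg a b]
  | cons c l =>
    simp only [listCost]
    linarith [hw.triangle a b c]

lemma listCost_cons_le_of_sublist (hw : IsMetric w) {l l' : List V} (h : l.Sublist l') (a : V) :
    listCost w (a :: l) ≤ listCost w (a :: l') := by
  induction h generalizing a with
  | slnil => exact le_rfl
  | @cons l l' b h ih =>
    exact (hw.listCost_cons_le a b l).trans (by simpa [listCost] using ih b)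
  | @cons_cons l l' b h ih => simpa [listCost] using ih b

lemma listCost_eq_of_isRoute (hw : IsMetric w) {a b : V} {l : List V} {N : Multiset (Sym2 V)}
    (h : IsRoute a b l N) :
    listCost w (l ++ [b]) = (N.map (sym2Weight w)).sum := by
  induction h with
  | nil a => simp [listCost, hw.self]
  | cons a h ih =>
    obtain ⟨t, rfl⟩ := h.exists_eq_cons
    simp only [List.cons_append, listCost, Multiset.map_cons, Multiset.sum_cons,
      hw.sym2Weight_mk_s10] at ih ⊢
    rw [ih]

end IsMetric

lemma listCost_eq_sum (w : V → V → ℝ) (a : V) (l : List V) :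
    listCost w (a :: l) =
      ∑ i : Fin l.length, w ((a :: l)[(i : ℕ)]'(by simp)) (l[(i : ℕ)]) := by
  induction l generalizing a with
  | nil => simp [listCost]
  | cons b l ih =>
    rw [listCost, ih]
    exact (Fin.sum_univ_succ (n := l.length)
      (fun i => w ((a :: b :: l)[(i : ℕ)]'(by simp)) ((b :: l)[(i : ℕ)]))).symm

lemma IsMetric.TSPcost_le_listCost [Fintype V] {w : V → V → ℝ} (hw : IsMetric w) (a : V)
    (l : List V) (hnd : (a :: l).Nodup) (hall : ∀ v, v ∈ a :: l) :
    TSPcost V w ≤ listCost w (a :: (l ++ [a])) := by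
  have hcard : Fintype.card V = (a :: l).length := by
    rw [← List.toFinset_card_of_nodup hnd, ← Finset.card_univ]
    congr 1
    ext v
    simpa using hall v
  let f : Fin (Fintype.card V) ≃ V :=
    (finCongr hcard).trans (hnd.getEquivOfForallMemList _ hall)
  have hf : ∀ i, f i = (a :: l)[(i : ℕ)]'(hcard ▸ i.2) := fun i => rfl
  refine le_of_le_of_eq (b := tourCost V w f) (csInf_le ⟨0, ?_⟩ ⟨f, rfl⟩) ?_
  · rintro _ ⟨g, rfl⟩
    exact Finset.sum_nonneg fun i _ => hw.nonneg _ _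
  · rw [listCost_eq_sum, tourCost]
    have hlen : Fintype.card V = (l ++ [a]).length := by simp [hcard]
    refine Fintype.sum_equiv (finCongr hlen) _ _ fun i => ?_
    rw [hf, hf]
    have hi := i.2
    simp only [finCongr_apply, Fin.val_cast]
    simp only [hcard] at hi ⊢
    rw [List.length_cons] at hi
    congr 1
    · exact (List.getElem_append_left (bs := [a]) _).symm
    · rcases Nat.lt_succ_iff_lt_or_eq.mp hi with h | h
      · simp [Nat.mod_eq_of_lt (Nat.succ_lt_succ h), h]
      · simp [h]

/-- Shortcutting an Eulerian tour of a connected multigraph `M` all of whose degrees are even. -/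
lemma IsMetric.TSPcost_le_of_even [Fintype V] [Nonempty V] {w : V → V → ℝ} (hw : IsMetric w)
    (T : SimpleGraph V) (hT : T.Connected) (M : Multiset (Sym2 V)) (hTM : ∀ e ∈ T.edgeSet, e ∈ M)
    (hM : (M.map sym2Boundary).sum = 0) :
    TSPcost V w ≤ (M.map (sym2Weight w)).sum := by
  obtain ⟨a⟩ := ‹Nonempty V›
  obtain ⟨l, N, hN, hl, hcl⟩ := exists_isRoute M a a (by rw [hM, zmod_two_add_self])
  have hall : ∀ v, v ∈ l := by
    intro v
    obtain ⟨p⟩ := hT.preconnected v a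
    induction p with
    | nil => exact hl.start_mem
    | @cons u v _ h p ih =>
      exact hcl s(u, v) (hTM _ h) v (by simp) u (by simp) (ih hl)
  have hcost := hw.listCost_eq_of_isRoute hl
  obtain ⟨t, rfl⟩ := hl.exists_eq_cons
  have hsub : ((t.filter (· ≠ a)).dedup).Sublist t :=
    (List.dedup_sublist _).trans List.filter_sublist
  refine (hw.TSPcost_le_listCost a (t.filter (· ≠ a)).dedup ?_ ?_).trans ?_
  · simp [List.nodup_dedup]
  · intro v
    have := hall v
    by_cases hva : v = a <;> simp_all
  · refine (hw.listCost_cons_le_of_sublist (hsub.append_right [a]) a).trans ?_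
    rw [List.cons_append] at hcost
    rw [hcost]
    obtain ⟨R, rfl⟩ := Multiset.le_iff_exists_add.mp hN
    rw [Multiset.map_add, Multiset.sum_add]
    refine le_add_of_nonneg_right (Multiset.sum_nonneg fun x hx => ?_)
    obtain ⟨e, -, rfl⟩ := Multiset.mem_map.mp hx
    exact hw.sym2Weight_nonneg e

lemma SimpleGraph.Walk.sum_sym2Boundary_edges {G : SimpleGraph V} {u v : V} (p : G.Walk u v) :
    (p.edges.map sym2Boundary).sum = Pi.single u 1 + Pi.single v 1 := by
  induction p with
  | nil => simp [zmod_two_add_self]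
  | @cons u v x h p ih =>
    rw [SimpleGraph.Walk.edges_cons, List.map_cons, List.sum_cons, ih, sym2Boundary_mk]
    have := zmod_two_add_self (Pi.single v (1 : ZMod 2))
    linear_combination this

lemma SimpleGraph.IsTree.covers_iff {T : SimpleGraph V} (hT : T.IsTree) {u v : V}
    {p : T.Walk u v} (hp : p.IsPath) (f : Sym2 V) : covers T s(u, v) f ↔ f ∈ p.edges := by
  refine ⟨?_, fun hf => ⟨u, v, p, rfl, hp, hf⟩⟩
  rintro ⟨x, y, q, hxy, hq, hf⟩
  rcases Sym2.eq_iff.mp hxy with ⟨rfl, rfl⟩ | ⟨rfl, rfl⟩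
  · rwa [(hT.existsUnique_path _ _).unique hp hq]
  · rw [(hT.existsUnique_path _ _).unique hp hq.reverse]
    simpa using hf

/-- The tree path of a pair has the same boundary as the pair. -/
lemma SimpleGraph.IsTree.sum_covers_sym2Boundary [Fintype V] {T : SimpleGraph V} (hT : T.IsTree)
    (e : Sym2 V) :
    ∑ f ∈ T.edgeFinset with covers T e f, sym2Boundary f = sym2Boundary e := by
  induction e with
  | _ u v =>
  obtain ⟨p, hp, -⟩ := hT.existsUnique_path u v
  rw [sym2Boundary_mk, ← p.sum_sym2Boundary_edges,
    ← List.sum_toFinset _ hp.isTrail.edges_nodup]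
  refine Finset.sum_congr ?_ fun _ _ => rfl
  ext f
  simp only [Finset.mem_filter, SimpleGraph.mem_edgeFinset, List.mem_toFinset,
    hT.covers_iff hp]
  exact ⟨And.right, fun h => ⟨p.edges_subset_edgeSet h, h⟩⟩

/-- The pairs in `S`, together with the tree edges, where a tree edge is doubled if it is covered
by an even number of pairs in `S`. -/
noncomputable def coverMultigraph [Fintype V] (T : SimpleGraph V) (S : Finset (Sym2 V)) :
    Multiset (Sym2 V) :=
  S.val + (T.edgeFinset.val +
    (T.edgeFinset.filter fun f => Even (S.filter fun e => covers T e f).card).val)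

lemma sum_map_coverMultigraph [Fintype V] {A : Type*} [AddCommMonoid A] (T : SimpleGraph V)
    (S : Finset (Sym2 V)) (g : Sym2 V → A) :
    ((coverMultigraph T S).map g).sum = ∑ e ∈ S, g e + (∑ f ∈ T.edgeFinset, g f +
      ∑ f ∈ T.edgeFinset, if Even (S.filter fun e => covers T e f).card then g f else 0) := by
  rw [coverMultigraph, Multiset.map_add, Multiset.sum_add, Multiset.map_add, Multiset.sum_add,
    ← Finset.sum_filter]
  rfl

lemma SimpleGraph.IsTree.sum_boundary_coverMultigraph [Fintype V] {T : SimpleGraph V}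
    (hT : T.IsTree) (S : Finset (Sym2 V)) :
    ((coverMultigraph T S).map sym2Boundary).sum = 0 := by
  have hS : ∑ e ∈ S, sym2Boundary e = ∑ f ∈ T.edgeFinset,
      (S.filter fun e => covers T e f).card • sym2Boundary f := by
    rw [← Finset.sum_congr rfl fun e _ => hT.sum_covers_sym2Boundary e]
    simp_rw [Finset.sum_filter]
    rw [Finset.sum_comm]
    refine Finset.sum_congr rfl fun f _ => ?_
    rw [← Finset.sum_filter, Finset.sum_const]
  rw [sum_map_coverMultigraph, hS, ← Finset.sum_add_distrib, ← Finset.sum_add_distrib]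
  refine Finset.sum_eq_zero fun f _ => ?_
  have h2 : ∀ k : ℕ, (k + k) • sym2Boundary f = 0 := fun k => by
    rw [add_nsmul, zmod_two_add_self]
  split_ifs with h
  · obtain ⟨k, hk⟩ := h
    rw [hk, h2, zmod_two_add_self, add_zero]
  · obtain ⟨k, hk⟩ := Nat.not_even_iff_odd.mp h
    rw [hk, add_nsmul, two_mul, h2, one_nsmul, zero_add, add_zero, zmod_two_add_self]

/-- Averaging over all subsets of `E` shows that one of the multigraphs is cheap. -/
lemma exists_coverMultigraph_cost_le [Fintype V] (T : SimpleGraph V) (E : Finset (Sym2 V))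
    (c : Sym2 V → ℝ) :
    ∃ S, ((coverMultigraph T S).map c).sum ≤ (∑ e ∈ E, c e) / 2 + 2 * ∑ f ∈ T.edgeFinset, c f -
      (∑ f ∈ T.edgeFinset with ∃ e ∈ E, covers T e f, c f) / 2 := by
  suffices h : ∑ S ∈ E.powerset, ((coverMultigraph T S).map c).sum =
      ∑ S ∈ E.powerset, ((∑ e ∈ E, c e) / 2 + 2 * ∑ f ∈ T.edgeFinset, c f -
        (∑ f ∈ T.edgeFinset with ∃ e ∈ E, covers T e f, c f) / 2) by
    obtain ⟨S, -, hS⟩ := Finset.exists_le_of_sum_le ⟨∅, Finset.empty_mem_powerset E⟩ h.le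
    exact ⟨S, hS⟩
  have hpairs : ∑ S ∈ E.powerset, ∑ e ∈ S, c e = 2 ^ E.card * ((∑ e ∈ E, c e) / 2) := by
    have h1 : ∀ S ∈ E.powerset, ∑ e ∈ S, c e =
        ∑ e ∈ E, (1 - if Even (S.filter (· = e)).card then (1 : ℝ) else 0) * c e := by
      intro S hS
      rw [← Finset.sum_subset (Finset.mem_powerset.mp hS)]
      · refine Finset.sum_congr rfl fun e he => ?_
        simp [Finset.filter_eq', he]
      · intro e _ he
        simp [Finset.filter_eq', he]
    rw [Finset.sum_congr rfl h1, Finset.sum_comm, Finset.sum_div, Finset.mul_sum]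
    refine Finset.sum_congr rfl fun e he => ?_
    rw [← Finset.sum_mul, Finset.sum_sub_distrib, sum_powerset_even_filter E (· = e) ⟨e, he, rfl⟩]
    simp [Finset.card_powerset]
    ring
  have hedges : ∑ S ∈ E.powerset, ∑ f ∈ T.edgeFinset,
      (if Even (S.filter fun e => covers T e f).card then c f else 0) =
      2 ^ E.card * (∑ f ∈ T.edgeFinset, c f -
        (∑ f ∈ T.edgeFinset with ∃ e ∈ E, covers T e f, c f) / 2) := by
    rw [Finset.sum_comm, Finset.sum_filter, Finset.sum_div, ← Finset.sum_sub_distrib,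
      Finset.mul_sum]
    refine Finset.sum_congr rfl fun f _ => ?_
    have h1 : ∀ S ∈ E.powerset, (if Even (S.filter fun e => covers T e f).card then c f else 0) =
        (if Even (S.filter fun e => covers T e f).card then (1 : ℝ) else 0) * c f := by
      intro S _
      split_ifs <;> simp
    split_ifs with h
    · rw [Finset.sum_congr rfl h1, ← Finset.sum_mul, sum_powerset_even_filter E _ h]
      ring
    · push Not at h
      have h2 : ∀ S ∈ E.powerset,
          (if Even (S.filter fun e => covers T e f).card then c f else 0) = c f := by
        intro S hS
        rw [Finset.filter_false_of_mem fun e he => h e (Finset.mem_powerset.mp hS he)]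
        simp
      rw [Finset.sum_congr rfl h2]
      simp [Finset.card_powerset]
  simp_rw [sum_map_coverMultigraph]
  rw [Finset.sum_add_distrib, Finset.sum_add_distrib, hpairs, hedges, Finset.sum_const,
    Finset.sum_const, Finset.card_powerset, nsmul_eq_mul, nsmul_eq_mul]
  push_cast
  ring

lemma setWeight_eq_sum (w : V → V → ℝ) {S : Set (Sym2 V)} {F : Finset (Sym2 V)}
    (h : ∀ e, e ∈ S ↔ e ∈ F) : setWeight w S = ∑ e ∈ F, sym2Weight w e := by
  obtain rfl : S = F := Set.ext h
  exact finsum_mem_coe_finset _ _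

/-- Let `T` be a minimum spanning tree of the complete weighted graph on
`(V, w)`, let `0 < α < 1` and `0 < β < 1`, and let `E*` be a set of pairs of vertices with
`w(E*) ≤ α·w(cov(E*))` and `w(cov(E*)) ≥ β·MST(w)`.
Then `TSP(w) ≤ (2 − (1 − α)·β/2)·MST(w)`. -/
theorem tsp_upper_of_large_cover
    {V : Type*} [Fintype V] [Nonempty V] (w : V → V → ℝ) (hw : IsMetric w)
    (T : SimpleGraph V) (hT : T.IsTree)
    (hTmst : setWeight w T.edgeSet = MSTcost V w)
    (α β : ℝ) (hα0 : 0 < α) (hα1 : α < 1) (hβ0 : 0 < β) (hβ1 : β < 1)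
    (Estar : Set (Sym2 V))
    (h1 : setWeight w Estar ≤ α * setWeight w (cov T Estar))
    (h2 : β * MSTcost V w ≤ setWeight w (cov T Estar)) :
    TSPcost V w ≤ (2 - (1 - α) * β / 2) * MSTcost V w := by
  have hE : setWeight w Estar = ∑ e ∈ Estar.toFinset, sym2Weight w e :=
    setWeight_eq_sum w (by simp)
  have hF : setWeight w T.edgeSet = ∑ f ∈ T.edgeFinset, sym2Weight w f :=
    setWeight_eq_sum w (by simp)
  have hC : setWeight w (cov T Estar) =
      ∑ f ∈ T.edgeFinset with ∃ e ∈ Estar.toFinset, covers T e f, sym2Weight w f :=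
    setWeight_eq_sum w (by simp [cov])
  obtain ⟨S, hS⟩ := exists_coverMultigraph_cost_le T Estar.toFinset (sym2Weight w)
  have htsp := hw.TSPcost_le_of_even T hT.connected (coverMultigraph T S)
    (fun e he => by simp [coverMultigraph, he]) (hT.sum_boundary_coverMultigraph S)
  rw [← hE, ← hF, ← hC, hTmst] at hS
  nlinarith [mul_le_mul_of_nonneg_left h2 (sub_nonneg.mpr hα1.le)]
end

section
/- Let T be a minimum spanning tree of the complete weighted graph on (V, w), let T̂ be a subtree of T, and let Ê be a finite set of pairs of vertices, none of which is an edge of T, each having at least one endpoint in V(T̂). For each edge f of T̂ let cov_Ê(f) denote the number of pairs in Ê whose tree path contains f. Then for every integer k ≥ 2 and every real number δ with 0 < δ < 1/k: w(Ê) ≥ (1 − (k−1)δ)·∑_{f ∈ E(T̂)} w(f)·min{k, cov_Ê(f)} − adv(T̂)/(2δ). -/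
open scoped Classical

variable {V : Type*}

/-- A lower Bonferroni inequality for `n` independent events of probability `p`. -/
theorem mul_one_sub_le_one_sub_pow {p : ℝ} (hp0 : 0 ≤ p) (hp1 : p ≤ 1) (n : ℕ) :
    p * n * (1 - ((n : ℝ) - 1) * p / 2) ≤ 1 - (1 - p) ^ n := by
  induction n with
  | zero => simp
  | succ n ih =>
    have h := mul_le_mul_of_nonneg_left ih (sub_nonneg.2 hp1)
    have hn : (0 : ℝ) ≤ n * ((n : ℝ) - 1) := by
      cases n with
      | zero => simp
      | succ m => push_cast; ring_nf; positivity
    have hn3 : 0 ≤ (n * ((n : ℝ) - 1)) * p ^ 3 := mul_nonneg hn (pow_nonneg hp0 3)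
    rw [pow_succ]
    push_cast
    linarith

/-- The bound of `mul_one_sub_le_one_sub_pow` with the number of events truncated at `k`. -/
theorem mul_min_le_one_sub_pow {δ : ℝ} (hδ : 0 ≤ δ) (hδ1 : 2 * δ ≤ 1) (k n : ℕ) :
    2 * δ * ((1 - ((k : ℝ) - 1) * δ) * (min k n : ℕ)) ≤ 1 - (1 - 2 * δ) ^ n := by
  have h := mul_one_sub_le_one_sub_pow (by positivity : 0 ≤ 2 * δ) hδ1 (min k n)
  have hpow : (1 - 2 * δ) ^ n ≤ (1 - 2 * δ) ^ min k n :=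
    pow_le_pow_of_le_one (by linarith) (by linarith) (min_le_right _ _)
  have hm : ((min k n : ℕ) : ℝ) ≤ k := by exact_mod_cast min_le_left k n
  have hle : 2 * δ * (min k n : ℕ) * (((min k n : ℕ) : ℝ) * δ) ≤
      2 * δ * (min k n : ℕ) * (k * δ) := by gcongr
  linarith

/-- Some subset of `E` has cover advantage at least the expected cover advantage of a random
subset of `E` containing each element independently with probability `p`. -/
theorem exists_subset_expected_advantage_le {α β : Type*} (R : α → β → Prop) (x : β → ℝ)
    (c : α → ℝ) {p : ℝ} (hp0 : 0 ≤ p) (hp1 : p ≤ 1) (E : Finset α) (F : Finset β) :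
    ∃ S ⊆ E,
      ∑ f ∈ F, x f * (1 - (1 - p) ^ (E.filter (fun e => R e f)).card) - p * ∑ e ∈ E, c e ≤
        ∑ f ∈ F.filter (fun f => ∃ e ∈ S, R e f), x f - ∑ e ∈ S, c e := by
  induction E using Finset.induction_on generalizing F with
  | empty => exact ⟨∅, subset_rfl, by simp⟩
  | insert a E ha ih =>
    obtain ⟨S₁, hS₁, h₁⟩ := ih (F.filter (fun f => ¬ R a f))
    obtain ⟨S₂, hS₂, h₂⟩ := ih F
    have haS₁ : a ∉ S₁ := fun h => ha (hS₁ h)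
    have hsplit : ∑ f ∈ F, x f * (1 - (1 - p) ^ ((insert a E).filter (fun e => R e f)).card) =
        p * (∑ f ∈ F.filter (fun f => R a f), x f +
          ∑ f ∈ F.filter (fun f => ¬ R a f),
            x f * (1 - (1 - p) ^ (E.filter (fun e => R e f)).card)) +
        (1 - p) * ∑ f ∈ F, x f * (1 - (1 - p) ^ (E.filter (fun e => R e f)).card) := by
      rw [Finset.sum_filter, Finset.sum_filter, ← Finset.sum_add_distrib, Finset.mul_sum,
        Finset.mul_sum, ← Finset.sum_add_distrib]
      refine Finset.sum_congr rfl fun f _ => ?_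
      by_cases h : R a f
      · rw [Finset.filter_insert, if_pos h, Finset.card_insert_of_notMem (by simp [ha])]
        simp only [h, if_true, not_true, if_false]
        ring
      · rw [Finset.filter_insert, if_neg h]
        simp only [h, if_false, not_false_eq_true, if_true]
        ring
    have hcov : ∑ f ∈ F.filter (fun f => ∃ e ∈ insert a S₁, R e f), x f =
        ∑ f ∈ F.filter (fun f => R a f), x f +
          ∑ f ∈ (F.filter (fun f => ¬ R a f)).filter (fun f => ∃ e ∈ S₁, R e f), x f := by
      rw [Finset.filter_filter, Finset.sum_filter, Finset.sum_filter, Finset.sum_filter,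
        ← Finset.sum_add_distrib]
      refine Finset.sum_congr rfl fun f _ => ?_
      by_cases h : R a f <;> simp [h]
    by_cases hbest : ∑ f ∈ F, x f * (1 - (1 - p) ^ ((insert a E).filter (fun e => R e f)).card) -
        p * ∑ e ∈ insert a E, c e ≤
        ∑ f ∈ F.filter (fun f => ∃ e ∈ S₂, R e f), x f - ∑ e ∈ S₂, c e
    · exact ⟨S₂, hS₂.trans (Finset.subset_insert a E), hbest⟩
    · refine ⟨insert a S₁, Finset.insert_subset_insert a hS₁, ?_⟩
      rw [hcov, Finset.sum_insert haS₁]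
      rw [hsplit, Finset.sum_insert ha] at hbest ⊢
      have h₁' := mul_le_mul_of_nonneg_left h₁ hp0
      have h₂' := mul_le_mul_of_nonneg_left h₂ (sub_nonneg.2 hp1)
      by_contra! hlt
      have h₄ := mul_le_mul_of_nonneg_left (not_le.1 hbest).le (sub_nonneg.2 hp1)
      rcases hp0.eq_or_lt with rfl | hp
      · linarith
      · have h₃ := mul_lt_mul_of_pos_left hlt hp
        linarith

theorem sym2Weight_nonneg {V : Type*} {w : V → V → ℝ} (hw : ∀ x y, 0 ≤ w x y) (e : Sym2 V) :
    0 ≤ sym2Weight w e := by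
  induction e with
  | h a b => exact div_nonneg (add_nonneg (hw a b) (hw b a)) zero_le_two

theorem IsMetric.nonneg_s14 {V : Type*} {w : V → V → ℝ} (hw : IsMetric w) (x y : V) :
    0 ≤ w x y := by
  rcases eq_or_ne x y with rfl | h
  · exact (hw.self x).ge
  · exact (hw.pos x y h).le

theorem advOf_le_adv {V : Type*} [Finite V] (w : V → V → ℝ) (T : SimpleGraph V)
    (T' : T.Subgraph) (E : Set (Sym2 V)) (hE : ∀ e ∈ E, ∃ u ∈ T'.verts, u ∈ e) :
    advOf w T E T' ≤ adv w T T' := by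
  refine le_csSup (((Set.finite_range fun E => advOf w T E T').subset ?_).bddAbove)
    ⟨E, hE, rfl⟩
  rintro _ ⟨E', -, rfl⟩
  exact ⟨E', rfl⟩

/-- Let `T` be a minimum spanning tree of the complete weighted graph on
`(V, w)`, let `T̂` be a subtree of `T` and let `Ê` be a finite set of pairs of vertices,
none an edge of `T`, each with at least one endpoint in `V(T̂)`. Writing `cov_Ê(f)` for
the number of pairs of `Ê` covering the edge `f`, for every integer `k ≥ 2` and real
`0 < δ < 1/k` we have
`w(Ê) ≥ (1 − (k−1)δ)·∑_{f ∈ E(T̂)} w(f)·min{k, cov_Ê(f)} − adv(T̂)/(2δ)`. -/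
theorem weight_lower_bound_from_cover_counts
    {V : Type*} [Fintype V] (w : V → V → ℝ) (hw : IsMetric w)
    (T : SimpleGraph V) (hT : T.IsTree)
    (hTmst : setWeight w T.edgeSet = MSTcost V w)
    (That : T.Subgraph) (hThat : IsSubtree T That)
    (Ehat : Finset (Sym2 V))
    (hnotTree : ∀ e ∈ Ehat, e ∉ T.edgeSet)
    (hnotDiag : ∀ e ∈ Ehat, ¬ e.IsDiag)
    (helig : ∀ e ∈ Ehat, ∃ u ∈ That.verts, u ∈ e)
    (k : ℕ) (hk : 2 ≤ k) (δ : ℝ) (hδ0 : 0 < δ) (hδk : δ < 1 / k) :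
    (1 - ((k : ℝ) - 1) * δ) *
        (∑ᶠ f ∈ That.edgeSet,
          sym2Weight w f * (min k ((Ehat.filter (fun e => covers T e f)).card) : ℝ))
      - adv w T That / (2 * δ)
      ≤ ∑ e ∈ Ehat, sym2Weight w e := by
  have hk2 : (2 : ℝ) ≤ k := by exact_mod_cast hk
  have hδ1 : 2 * δ ≤ 1 := by
    rw [lt_div_iff₀ (by linarith)] at hδk
    nlinarith
  set F := That.edgeSet.toFinset with hF
  obtain ⟨S, hS, h⟩ := exists_subset_expected_advantage_le (covers T) (sym2Weight w)
    (sym2Weight w) (by positivity : 0 ≤ 2 * δ) hδ1 Ehat F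
  have hcovOn : covOn T (S : Set (Sym2 V)) That =
      (F.filter (fun f => ∃ e ∈ S, covers T e f) : Finset (Sym2 V)) := by
    ext f
    simp only [covOn, cov, hF, Finset.coe_filter, Set.mem_toFinset, Set.mem_inter_iff,
      Set.mem_ofPred_eq, Finset.mem_coe]
    exact ⟨fun h => ⟨h.2, h.1.2⟩, fun h => ⟨⟨That.edgeSet_subset h.1, h.2⟩, h.1⟩⟩
  have hadv := advOf_le_adv w T That S fun e he => helig e (hS he)
  rw [advOf, hcovOn, setWeight, setWeight, finsum_mem_coe_finset, finsum_mem_coe_finset] at hadv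
  have hsum : 2 * δ * ((1 - ((k : ℝ) - 1) * δ) * ∑ f ∈ F,
      sym2Weight w f * (min k ((Ehat.filter (fun e => covers T e f)).card) : ℝ)) ≤
      ∑ f ∈ F, sym2Weight w f *
        (1 - (1 - 2 * δ) ^ (Ehat.filter (fun e => covers T e f)).card) := by
    rw [Finset.mul_sum, Finset.mul_sum]
    refine Finset.sum_le_sum fun f _ => ?_
    have hf := mul_le_mul_of_nonneg_left
      (mul_min_le_one_sub_pow hδ0.le hδ1 k (Ehat.filter (fun e => covers T e f)).card)
      (sym2Weight_nonneg hw.nonneg_s14 f)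
    push_cast at hf
    linarith
  have hfin : ∀ g : Sym2 V → ℝ, ∑ᶠ f ∈ That.edgeSet, g f = ∑ f ∈ F, g f := fun g => by
    rw [← finsum_mem_coe_finset, hF, Set.coe_toFinset]
  rw [hfin, sub_le_iff_le_add, ← sub_le_iff_le_add', le_div_iff₀ (by positivity)]
  linarith
end
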